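/- Let l be a low-frequency cutoff. Then there exists a constant c > 0 such that for every real λ ≥ 1, every integer n ≥ 1 and every real t ≥ 0, the approximate renormalisation constant 𝔯ⁿ_λ(t) := (1/4)·∑_{k ∈ ℤ²_*} l(|k|/λ)·l(|k|/n)·(1 − exp(−2|k|²t))/(|k|²/2 + 1) satisfies 𝔯ⁿ_λ(t) ≤ c·log(min(λ, n)). -/

import Mathlib

open scoped BigOperators

/-- The Euclidean norm of a lattice point `k ∈ ℤ²`. -/
noncomputable def knorm (k : ℤ × ℤ) : ℝ := Real.sqrt ((k.1 : ℝ)^2 + (k.2 : ℝ)^2)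

/-- The punctured square `{k ∈ ℤ² : 1 ≤ max |k₁| |k₂| ≤ N}`. -/
noncomputable def puncturedSquare (N : ℕ) : Finset (ℤ × ℤ) :=
  (Finset.Icc 1 N).biUnion fun j => Finset.box j

theorem mem_puncturedSquare {N : ℕ} {k : ℤ × ℤ} :
    k ∈ puncturedSquare N ↔
      1 ≤ max k.1.natAbs k.2.natAbs ∧ max k.1.natAbs k.2.natAbs ≤ N := by
  simp only [puncturedSquare, Finset.mem_biUnion, Int.mem_box, Finset.mem_Icc]
  exact ⟨by rintro ⟨j, hj, h⟩; omega, fun h => ⟨_, h, rfl⟩⟩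

theorem max_natAbs_le_knorm (k : ℤ × ℤ) :
    ((max k.1.natAbs k.2.natAbs : ℕ) : ℝ) ≤ knorm k := by
  rw [Nat.cast_max, Nat.cast_natAbs, Nat.cast_natAbs, Int.cast_abs, Int.cast_abs]
  refine max_le ?_ ?_ <;> refine Real.abs_le_sqrt ?_
  · exact le_add_of_nonneg_right (sq_nonneg _)
  · exact le_add_of_nonneg_left (sq_nonneg _)

theorem one_le_max_natAbs {k : ℤ × ℤ} (hk : k ≠ 0) : 1 ≤ max k.1.natAbs k.2.natAbs := by
  by_contra h
  exact hk (Prod.ext (by simp; omega) (by simp; omega))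

theorem one_le_knorm {k : ℤ × ℤ} (hk : k ≠ 0) : 1 ≤ knorm k :=
  le_trans (by exact_mod_cast one_le_max_natAbs hk) (max_natAbs_le_knorm k)

/-- The lattice sum of `1 / (|k|² / 2 + 1)` over a punctured square grows at most
logarithmically. -/
theorem sum_puncturedSquare_le (N : ℕ) :
    ∑ k ∈ puncturedSquare N, 1 / (knorm k ^ 2 / 2 + 1) ≤ 16 * (1 + Real.log N) := by
  have hdisj : ((Finset.Icc 1 N : Finset ℕ) : Set ℕ).PairwiseDisjoint
      fun j => (Finset.box j : Finset (ℤ × ℤ)) := by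
    intro i _ j _ hij
    refine Finset.disjoint_left.2 fun k hi hj => hij ?_
    rw [Int.mem_box] at hi hj
    exact hi.symm.trans hj
  have hbox : ∀ j ∈ Finset.Icc 1 N,
      ∑ k ∈ (Finset.box j : Finset (ℤ × ℤ)), 1 / (knorm k ^ 2 / 2 + 1) ≤ 16 * (j : ℝ)⁻¹ := by
    intro j hj
    have hj1 : 1 ≤ j := (Finset.mem_Icc.1 hj).1
    have hj0 : (0 : ℝ) < j := by exact_mod_cast hj1
    calc _ ≤ ∑ k ∈ (Finset.box j : Finset (ℤ × ℤ)), 2 / (j : ℝ) ^ 2 := by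
          refine Finset.sum_le_sum fun k hk => ?_
          have hle := max_natAbs_le_knorm k
          rw [Int.mem_box.1 hk] at hle
          have hsq : (j : ℝ) ^ 2 ≤ knorm k ^ 2 := by gcongr
          rw [div_le_div_iff₀ (by positivity) (by positivity)]
          linarith
      _ = 16 * (j : ℝ)⁻¹ := by
          rw [Finset.sum_const, Int.card_box (by omega), nsmul_eq_mul]
          push_cast
          field_simp
          norm_num
  have hharm := harmonic_le_one_add_log N
  rw [harmonic_eq_sum_Icc] at hharm
  push_cast at hharm
  rw [puncturedSquare, Finset.sum_biUnion hdisj]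
  refine (Finset.sum_le_sum hbox).trans ?_
  rw [← Finset.mul_sum]
  gcongr

/-- A smooth function vanishing on `[1, ∞)` is bounded at `a / M`, for `a ≥ 1`, by a
multiple of `log M` when `M ≥ 1`. -/
theorem exists_cutoff_le_mul_log (l : ℝ → ℝ) (hl : ContDiff ℝ (⊤ : ℕ∞) l)
    (hl_zero : ∀ r : ℝ, 1 ≤ r → l r = 0) :
    ∃ K : ℝ, 0 ≤ K ∧ ∀ a M : ℝ, 1 ≤ a → 1 ≤ M → l (a / M) ≤ K * Real.log M := by
  obtain ⟨K, hK⟩ := (hl.contDiffOn (s := Set.Icc (0 : ℝ) 1)).exists_lipschitzOnWith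
    (by simp) (convex_Icc 0 1) isCompact_Icc
  refine ⟨K, K.2, fun a M ha hM => ?_⟩
  have hM0 : 0 < M := by linarith
  have hlog := Real.one_sub_inv_le_log_of_pos hM0
  rcases le_total 1 (a / M) with h | h
  · rw [hl_zero _ h]
    exact mul_nonneg K.2 (Real.log_nonneg hM)
  · have hinv : M⁻¹ ≤ a / M := by
      rw [inv_eq_one_div]
      gcongr
    have hd := hK.dist_le_mul (a / M) ⟨by positivity, h⟩ 1 ⟨zero_le_one, le_rfl⟩
    rw [hl_zero 1 le_rfl, Real.dist_eq, Real.dist_eq, sub_zero, abs_sub_comm,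
      abs_of_nonneg (sub_nonneg.2 h)] at hd
    refine (le_abs_self _).trans (hd.trans ?_)
    gcongr
    linarith

/-- Let `l` be a low-frequency cutoff. Then there is a constant `c > 0`
such that for all real `λ ≥ 1`, integer `n ≥ 1` and real `t ≥ 0` the approximate
renormalisation constant
`𝔯ⁿ_λ(t) = (1/4)·∑_{k ∈ ℤ²∖{0}} l(|k|/λ)·l(|k|/n)·(1 − exp(−2|k|²t))/(|k|²/2 + 1)`
satisfies `𝔯ⁿ_λ(t) ≤ c·log(min(λ, n))`. -/
theorem approximate_renormalisation_constant_log_bound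
    (l : ℝ → ℝ)
    (hl_smooth : ContDiff ℝ (⊤ : ℕ∞) l)
    (hl_mem : ∀ r : ℝ, l r ∈ Set.Icc (0:ℝ) 1)
    (hl_one : ∀ r : ℝ, r ≤ 1/2 → l r = 1)
    (hl_zero : ∀ r : ℝ, 1 ≤ r → l r = 0) :
    ∃ c : ℝ, 0 < c ∧ ∀ lam : ℝ, 1 ≤ lam → ∀ n : ℕ, 1 ≤ n → ∀ t : ℝ, 0 ≤ t →
      (1/4) * ∑' k : {k : ℤ × ℤ // k ≠ 0},
          l (knorm k.1 / lam) * l (knorm k.1 / (n : ℝ))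
            * (1 - Real.exp (-2 * (knorm k.1)^2 * t)) / ((knorm k.1)^2 / 2 + 1)
        ≤ c * Real.log (min lam (n : ℝ)) := by
  obtain ⟨K, hK0, hK⟩ := exists_cutoff_le_mul_log l hl_smooth hl_zero
  refine ⟨4 * (K + 1), by positivity, fun lam hlam n hn t ht => ?_⟩
  set M : ℝ := min lam (n : ℝ) with hM_def
  have hM : 1 ≤ M := le_min hlam (by exact_mod_cast hn)
  have hM0 : 0 < M := by linarith
  have hlogM : 0 ≤ Real.log M := Real.log_nonneg hM
  set B : ℝ := min 1 (K * Real.log M)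
  have hB0 : 0 ≤ B := le_min zero_le_one (by positivity)
  have hprod : ∀ r : ℝ, l (r / lam) * l (r / (n : ℝ)) ≤ l (r / M) := by
    intro r
    rcases min_choice lam (n : ℝ) with h | h <;> rw [hM_def, h]
    · exact mul_le_of_le_one_right (hl_mem _).1 (hl_mem _).2
    · exact mul_le_of_le_one_left (hl_mem _).1 (hl_mem _).2
  set f : ℤ × ℤ → ℝ := fun k => l (knorm k / lam) * l (knorm k / (n : ℝ))
            * (1 - Real.exp (-2 * (knorm k)^2 * t)) / ((knorm k)^2 / 2 + 1) with hf
  have hf_le : ∀ k : ℤ × ℤ, k ≠ 0 → f k ≤ B * (1 / (knorm k ^ 2 / 2 + 1)) := by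
    intro k hk
    have hlB : l (knorm k / lam) * l (knorm k / (n : ℝ)) ≤ B :=
      (hprod _).trans (le_min (hl_mem _).2 (hK _ _ (one_le_knorm hk) hM))
    rw [mul_one_div]
    refine div_le_div_of_nonneg_right ?_ (by positivity)
    exact (mul_le_of_le_one_right (mul_nonneg (hl_mem _).1 (hl_mem _).1)
      (by linarith [Real.exp_pos (-2 * (knorm k)^2 * t)])).trans hlB
  have hf_zero : ∀ k ∉ puncturedSquare ⌊M⌋₊, Set.indicator {k : ℤ × ℤ | k ≠ 0} f k = 0 := by
    intro k hk
    refine Set.indicator_apply_eq_zero.2 fun hk0 => ?_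
    have hlt : M < knorm k := by
      refine lt_of_lt_of_le ((Nat.floor_lt hM0.le).1 ?_) (max_natAbs_le_knorm k)
      by_contra h
      exact hk (mem_puncturedSquare.2 ⟨one_le_max_natAbs hk0, not_lt.1 h⟩)
    have hl0 : l (knorm k / lam) * l (knorm k / (n : ℝ)) = 0 := by
      refine le_antisymm ((hprod _).trans_eq (hl_zero _ ?_))
        (mul_nonneg (hl_mem _).1 (hl_mem _).1)
      rw [one_le_div hM0]
      exact hlt.le
    simp only [hf, hl0, zero_mul, zero_div]
  have htsum : ∑' k : {k : ℤ × ℤ // k ≠ 0}, f k.1 ≤ B * (16 * (1 + Real.log M)) := by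
    have heq := tsum_subtype {k : ℤ × ℤ | k ≠ 0} f
    rw [tsum_eq_sum hf_zero] at heq
    refine heq.trans_le ?_
    calc _ ≤ ∑ k ∈ puncturedSquare ⌊M⌋₊, B * (1 / (knorm k ^ 2 / 2 + 1)) := by
          refine Finset.sum_le_sum fun k _ => ?_
          refine Set.indicator_apply_le' (fun hk => hf_le k hk) fun _ => by positivity
      _ ≤ B * (16 * (1 + Real.log M)) := by
          rw [← Finset.mul_sum]
          have hfloor : (0 : ℝ) < (⌊M⌋₊ : ℝ) := by
            exact_mod_cast Nat.floor_pos.2 hM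
          refine mul_le_mul_of_nonneg_left ((sum_puncturedSquare_le _).trans ?_) hB0
          gcongr
          exact Nat.floor_le hM0.le
  have hB1 : B * Real.log M ≤ Real.log M :=
    mul_le_of_le_one_left hlogM (min_le_left _ _)
  have hB2 : B ≤ K * Real.log M := min_le_right _ _
  linarith
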